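/- (Second dissociation theorem) A field extension L/K admits a Galois composition tower — that is, a strict Galois tower K = F_0 < F_1 < … < F_m = L in which every step F_{i+1}/F_i is a galsimple extension — if and only if L/K is galtourable and of finite degree. -/

import Mathlib

/-- A Galois tower of the extension `L/K`: a finite increasing chain of intermediate
fields from `K` (i.e. `⊥`) to `L` (i.e. `⊤`) each of whose steps is a Galois extension. -/
def IsGaloisTower {K L : Type*} [Field K] [Field L] [Algebra K L] {m : ℕ}
    (F : Fin (m + 1) → IntermediateField K L) : Prop :=
  Monotone F ∧ F 0 = ⊥ ∧ F (Fin.last m) = ⊤ ∧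
    ∀ i : Fin m, ∀ h : F i.castSucc ≤ F i.succ,
      IsGalois (F i.castSucc) (IntermediateField.extendScalars h)

/-- An extension `L/K` is galtourable if it admits a Galois tower. -/
def Galtourable (K L : Type*) [Field K] [Field L] [Algebra K L] : Prop :=
  ∃ (m : ℕ) (F : Fin (m + 1) → IntermediateField K L), IsGaloisTower F


/-- An extension `L/K` is galsimple if it is nontrivial and admits no proper nontrivial
Galois quotient extension: `L ≠ K`, and every intermediate field `F` with `F/K` Galois
satisfies `F = K` or `F = L`. -/
def Galsimple (K L : Type*) [Field K] [Field L] [Algebra K L] : Prop :=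
  (⊥ : IntermediateField K L) ≠ ⊤ ∧
    ∀ F : IntermediateField K L, IsGalois K F → F = ⊥ ∨ F = ⊤

/-- A Galois composition tower of `L/K`: a strict Galois tower all of whose steps are
galsimple extensions. -/
def IsGaloisCompositionTower {K L : Type*} [Field K] [Field L] [Algebra K L] {m : ℕ}
    (F : Fin (m + 1) → IntermediateField K L) : Prop :=
  StrictMono F ∧ IsGaloisTower F ∧
    ∀ i : Fin m, ∀ h : F i.castSucc ≤ F i.succ,
      Galsimple (F i.castSucc) (IntermediateField.extendScalars h)

open IntermediateField Relation

/-- A nontrivial Galois extension with no proper nontrivial Galois quotient is finite. -/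
theorem Galsimple.finiteDimensional {K L : Type*} [Field K] [Field L] [Algebra K L]
    [IsGalois K L] (h : Galsimple K L) : FiniteDimensional K L := by
  obtain ⟨x, -, hx⟩ := SetLike.exists_of_lt (bot_lt_iff_ne_bot.mpr h.1.symm)
  let E := FiniteGaloisIntermediateField.adjoin K {x}
  have hxE : x ∈ E.toIntermediateField :=
    FiniteGaloisIntermediateField.subset_adjoin K {x} (Set.mem_singleton x)
  rcases h.2 E.toIntermediateField E.isGalois with hE | hE
  · exact absurd (hE ▸ hxE) hx
  · have := E.finiteDimensional
    rw [hE] at this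
    exact Module.Finite.equiv topEquiv.toLinearEquiv

section

variable {K L : Type*} [Field K] [Field L] [Algebra K L]

/-- The extension `B/A` of intermediate fields is Galois. -/
def IsGaloisStep (A B : IntermediateField K L) : Prop :=
  ∃ h : A ≤ B, IsGalois A (extendScalars h)

/-- The extension `B/A` of intermediate fields is Galois and galsimple. -/
def IsGalsimpleStep (A B : IntermediateField K L) : Prop :=
  ∃ h : A ≤ B, IsGalois A (extendScalars h) ∧ Galsimple A (extendScalars h)

theorem IsGalsimpleStep.lt {A B : IntermediateField K L} (h : IsGalsimpleStep A B) : A < B := by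
  obtain ⟨hAB, -, hs⟩ := h
  refine lt_of_le_of_ne hAB ?_
  rintro rfl
  refine hs.1 (top_le_iff.mp fun x _ ↦ ?_)
  exact mem_bot.mpr ⟨⟨x.1, x.2⟩, rfl⟩

theorem IsGalsimpleStep.finiteDimensional {A B : IntermediateField K L}
    (h : IsGalsimpleStep A B) [FiniteDimensional K A] : FiniteDimensional K B := by
  obtain ⟨hAB, hg, hs⟩ := h
  have := hs.finiteDimensional
  have : FiniteDimensional K (extendScalars hAB) := FiniteDimensional.trans K A _
  exact this

theorem isGaloisCompositionTower_iff {m : ℕ} {F : Fin (m + 1) → IntermediateField K L} :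
    IsGaloisCompositionTower F ↔
      F 0 = ⊥ ∧ F (Fin.last m) = ⊤ ∧ ∀ i : Fin m, IsGalsimpleStep (F i.castSucc) (F i.succ) := by
  constructor
  · rintro ⟨-, ⟨hm, h0, hl, hg⟩, hs⟩
    exact ⟨h0, hl, fun i ↦ ⟨hm i.castSucc_lt_succ.le, hg i _, hs i _⟩⟩
  · rintro ⟨h0, hl, hs⟩
    have hm : StrictMono F := Fin.strictMono_iff_lt_succ.mpr fun i ↦ (hs i).lt
    exact ⟨hm, ⟨hm.monotone, h0, hl, fun i _ ↦ (hs i).2.1⟩, fun i _ ↦ (hs i).2.2⟩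

/-- A proper nontrivial Galois quotient of a Galois step splits it into two Galois steps. -/
theorem exists_isGaloisStep_of_not_galsimple {A B : IntermediateField K L} (hAB : A < B)
    [IsGalois A (extendScalars hAB.le)] (hs : ¬ Galsimple A (extendScalars hAB.le)) :
    ∃ C, A < C ∧ C < B ∧ IsGaloisStep A C ∧ IsGaloisStep C B := by
  have hne : (⊥ : IntermediateField A (extendScalars hAB.le)) ≠ ⊤ := by
    intro h
    refine hAB.not_ge fun x hx ↦ ?_
    have hxb : (⟨x, hx⟩ : extendScalars hAB.le) ∈
        (⊥ : IntermediateField A (extendScalars hAB.le)) := h ▸ mem_top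
    obtain ⟨a, ha⟩ := mem_bot.mp hxb
    have hax : (a : L) = x := congrArg Subtype.val ha
    exact hax ▸ a.2
  simp only [Galsimple, not_and, not_forall, not_or] at hs
  obtain ⟨F, hF, hbot, htop⟩ := hs hne
  let C : IntermediateField K L := (lift F).restrictScalars K
  have hAC : A ≤ C := fun x hx ↦ (lift F).algebraMap_mem ⟨x, hx⟩
  have hCB : C ≤ B := fun x hx ↦ lift_le F hx
  have hmem (x : extendScalars hAB.le) : x.1 ∈ C ↔ x ∈ F := mem_lift x
  refine ⟨C, hAC.lt_of_not_ge fun h ↦ hbot (le_bot_iff.mp fun x hx ↦ ?_),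
    hCB.lt_of_not_ge fun h ↦ htop (top_le_iff.mp fun x _ ↦ (hmem x).mp (h x.2)),
    ⟨hAC, ?_⟩, ⟨hCB, ?_⟩⟩
  · exact mem_bot.mpr ⟨⟨x.1, h ((hmem x).mpr hx)⟩, rfl⟩
  · exact IsGalois.of_algEquiv (liftAlgEquiv F)
  · exact IsGalois.of_equiv_equiv (F := F) (E := extendScalars hAB.le) (M := C)
      (N := extendScalars hCB) (f := (liftAlgEquiv F).toRingEquiv)
      (g := RingEquiv.refl (extendScalars hAB.le)) rfl

theorem IsGaloisStep.reflTransGen_isGalsimpleStep [FiniteDimensional K L]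
    {A B : IntermediateField K L} (h : IsGaloisStep A B) :
    ReflTransGen IsGalsimpleStep A B := by
  induction hn : Module.finrank K B - Module.finrank K A using Nat.strong_induction_on
    generalizing A B with
  | _ n ih =>
    have finrank_lt {E F : IntermediateField K L} (h : E < F) :
        Module.finrank K E < Module.finrank K F :=
      not_le.mp fun hle ↦ h.ne (eq_of_le_of_finrank_le h.le hle)
    obtain ⟨hAB, hg⟩ := h
    rcases hAB.eq_or_lt with rfl | hlt
    · exact .refl
    by_cases hs : Galsimple A (extendScalars hAB)
    · exact .single ⟨hAB, hg, hs⟩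
    obtain ⟨C, hAC, hCB, h₁, h₂⟩ := exists_isGaloisStep_of_not_galsimple hlt hs
    have := finrank_lt hAC
    have := finrank_lt hCB
    exact (ih _ (by omega) h₁ rfl).trans (ih _ (by omega) h₂ rfl)

end

theorem Relation.ReflTransGen.exists_fin_chain {α : Type*} {r : α → α → Prop} {a b : α}
    (h : ReflTransGen r a b) :
    ∃ (m : ℕ) (f : Fin (m + 1) → α), f 0 = a ∧ f (Fin.last m) = b ∧
      ∀ i : Fin m, r (f i.castSucc) (f i.succ) := by
  suffices ∃ s : RelSeries {p : α × α | r p.1 p.2}, s.head = a ∧ s.last = b by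
    obtain ⟨s, ha, hb⟩ := this
    exact ⟨s.length, s.toFun, ha, hb, s.step⟩
  induction h with
  | refl => exact ⟨.singleton _ a, rfl, rfl⟩
  | tail _ hr ih =>
    obtain ⟨s, ha, rfl⟩ := ih
    exact ⟨s.snoc _ hr, by simpa using ha, by simp⟩

/-- Second dissociation theorem: a field extension admits a Galois composition tower if
and only if it is galtourable and of finite degree. -/
theorem second_dissociation (K L : Type*) [Field K] [Field L] [Algebra K L] :
    (∃ (m : ℕ) (F : Fin (m + 1) → IntermediateField K L), IsGaloisCompositionTower F) ↔
      (Galtourable K L ∧ FiniteDimensional K L) := by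
  constructor
  · rintro ⟨m, F, hF⟩
    refine ⟨⟨m, F, hF.2.1⟩, ?_⟩
    obtain ⟨h0, hl, hs⟩ := isGaloisCompositionTower_iff.mp hF
    have hfin (i : Fin (m + 1)) : FiniteDimensional K (F i) := by
      induction i using Fin.induction with
      | zero => rw [h0]; infer_instance
      | succ i ih => exact (hs i).finiteDimensional
    have := hfin (Fin.last m)
    rw [hl] at this
    exact Module.Finite.equiv topEquiv.toLinearEquiv
  · rintro ⟨⟨m, F, hm, h0, hl, hg⟩, _⟩
    have hchain (i : Fin (m + 1)) : ReflTransGen IsGalsimpleStep (F 0) (F i) := by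
      induction i using Fin.induction with
      | zero => exact .refl
      | succ i ih =>
        have hle := hm i.castSucc_lt_succ.le
        exact ih.trans (IsGaloisStep.reflTransGen_isGalsimpleStep ⟨hle, hg i hle⟩)
    obtain ⟨n, G, hG⟩ := (hchain (Fin.last m)).exists_fin_chain
    rw [h0, hl] at hG
    exact ⟨n, G, isGaloisCompositionTower_iff.mpr hG⟩
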